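/- Consider the unit-disk SNL case (U, r, n, a) with exponents b, c > 0, and assume there exist ε ∈ (0,1) and p_r ∈ (0,1] such that for every x ∈ U the probability that an independent uniform random point s′ of U satisfies εr ≤ ‖x − s′‖ ≤ r is at least p_r. Consider the directly dimension-augmented loss function loss̃ : (ℝ^{n+d})^n → ℝ given by the same formula as the loss function but with variables x_j ∈ ℝ^{n+d} and with each anchor a_i replaced by its zero-padding (a_i, 0) ∈ ℝ^{n+d}. Then, writing v = ⌊√n⌋, there exists N ∈ ℕ such that for every number of sensors n > N, the probability that loss̃ is not convex is at least 1 − n·v·C(n−1, v−1)·(1−p_r)^{n−v}; in particular, for every p₀ < 1 there exists N such that for all n > N this probability exceeds p₀. -/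

import Mathlib

open MeasureTheory
open scoped Classical

/-- The uniform probability measure on a region `U` of Euclidean space. -/
noncomputable def unifMeasure {d : ℕ} (U : Set (EuclideanSpace ℝ (Fin d))) :
    Measure (EuclideanSpace ℝ (Fin d)) :=
  (volume U)⁻¹ • volume.restrict U

/-- Zero-padding of a point of `ℝ^d` to a point of `ℝ^{n+d}`. -/
noncomputable def padPoint {d : ℕ} (n : ℕ) (u : EuclideanSpace ℝ (Fin d)) :
    EuclideanSpace ℝ (Fin (n + d)) :=
  (WithLp.equiv 2 (Fin (n + d) → ℝ)).symm
    (fun k => if h : (k : ℕ) < d then u ⟨k, h⟩ else 0)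

/-- The directly dimension-augmented random loss function of the unit-disk SNL case:
the variables `x_j` live in `ℝ^{n+d}` and the anchors are padded with zeros. -/
noncomputable def udLossAug {d m : ℕ} (a : Fin m → EuclideanSpace ℝ (Fin d)) (r b c : ℝ)
    {n : ℕ} (S : Fin n → EuclideanSpace ℝ (Fin d))
    (x : Fin n → EuclideanSpace ℝ (Fin (n + d))) : ℝ :=
  ∑ p ∈ Finset.univ.filter
      (fun p : Fin n × Fin n => p.1 < p.2 ∧ dist (S p.1) (S p.2) ≤ r),
      |‖x p.1 - x p.2‖ ^ b - dist (S p.1) (S p.2) ^ b| ^ c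
    + ∑ p ∈ Finset.univ.filter
      (fun p : Fin m × Fin n => dist (a p.1) (S p.2) ≤ r),
      |‖padPoint n (a p.1) - x p.2‖ ^ b - dist (a p.1) (S p.2) ^ b| ^ c

theorem isProbabilityMeasure_unifMeasure {d : ℕ} {U : Set (EuclideanSpace ℝ (Fin d))}
    (hUne : U.Nonempty) (hUb : Bornology.IsBounded U) (hUopen : IsOpen U) :
    IsProbabilityMeasure (unifMeasure U) := by
  constructor
  simp only [unifMeasure, Measure.smul_apply, Measure.restrict_apply_univ, smul_eq_mul]
  exact ENNReal.inv_mul_cancel (hUopen.measure_pos volume hUne).ne' hUb.measure_lt_top.ne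

theorem ae_mem_unifMeasure {d : ℕ} {U : Set (EuclideanSpace ℝ (Fin d))} (hUopen : IsOpen U) :
    ∀ᵐ x ∂unifMeasure U, x ∈ U :=
  Measure.ae_smul_measure (ae_restrict_mem hUopen.measurableSet) _

theorem norm_padPoint {d : ℕ} (n : ℕ) (u : EuclideanSpace ℝ (Fin d)) :
    ‖padPoint n u‖ = ‖u‖ := by
  rw [EuclideanSpace.norm_eq, EuclideanSpace.norm_eq,
    ← Equiv.sum_comp (finCongr (add_comm d n)), Fin.sum_univ_add]
  simp [padPoint]

theorem padPoint_sub {d : ℕ} (n : ℕ) (u w : EuclideanSpace ℝ (Fin d)) :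
    padPoint n (u - w) = padPoint n u - padPoint n w := by
  ext k
  by_cases h : (k : ℕ) < d <;> simp [padPoint, h]

theorem norm_padPoint_sub {d : ℕ} (n : ℕ) (u w : EuclideanSpace ℝ (Fin d)) :
    ‖padPoint n u - padPoint n w‖ = dist u w := by
  rw [← padPoint_sub, norm_padPoint, dist_eq_norm]

theorem abs_rpow_sub_rpow_rpow_le {x y z b c : ℝ} (hx : 0 ≤ x) (hy : 0 ≤ y) (hxz : x ≤ z)
    (hyz : y ≤ z) (hb : 0 < b) (hc : 0 < c) : |x ^ b - y ^ b| ^ c ≤ (z ^ b) ^ c := by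
  refine Real.rpow_le_rpow (abs_nonneg _) ?_ hc.le
  have h₁ := Real.rpow_le_rpow hx hxz hb.le
  have h₂ := Real.rpow_le_rpow hy hyz hb.le
  have h₃ := Real.rpow_nonneg hx b
  have h₄ := Real.rpow_nonneg hy b
  exact abs_le.mpr ⟨by linarith, by linarith⟩

/-- A symmetric irreflexive relation in which each of `n` elements has at least `v` relatives
has at least `n * v / 2` unordered related pairs. -/
theorem mul_le_two_mul_card_filter_lt {n v : ℕ} (P : Fin n → Fin n → Prop)
    [∀ i j, Decidable (P i j)] (hsymm : ∀ i j, P i j → P j i) (hirr : ∀ i, ¬ P i i)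
    (hdeg : ∀ j, v ≤ (Finset.univ.filter (P j)).card) :
    n * v ≤ 2 * (Finset.univ.filter
      (fun p : Fin n × Fin n => p.1 < p.2 ∧ P p.1 p.2)).card := by
  have hswap : (Finset.univ.filter (fun p : Fin n × Fin n => p.2 < p.1 ∧ P p.1 p.2)).card =
      (Finset.univ.filter (fun p : Fin n × Fin n => p.1 < p.2 ∧ P p.1 p.2)).card := by
    refine Finset.card_bij (fun p _ => p.swap) ?_ ?_ ?_
    · intro p hp
      simp only [Finset.mem_filter, Finset.mem_univ, true_and, Prod.fst_swap,
        Prod.snd_swap] at hp ⊢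
      exact ⟨hp.1, hsymm _ _ hp.2⟩
    · intro p _ q _ h
      exact Prod.swap_injective h
    · intro p hp
      simp only [Finset.mem_filter, Finset.mem_univ, true_and] at hp
      exact ⟨p.swap, by simpa using ⟨hp.1, hsymm _ _ hp.2⟩, by simp⟩
  have htotal : (Finset.univ.filter (fun p : Fin n × Fin n => P p.1 p.2)).card =
      ∑ j, (Finset.univ.filter (P j)).card := by
    simp only [Finset.card_filter, Fintype.sum_prod_type]
  have hsplit : Finset.univ.filter (fun p : Fin n × Fin n => P p.1 p.2) ⊆
      Finset.univ.filter (fun p : Fin n × Fin n => p.1 < p.2 ∧ P p.1 p.2) ∪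
      Finset.univ.filter (fun p : Fin n × Fin n => p.2 < p.1 ∧ P p.1 p.2) := by
    intro p hp
    simp only [Finset.mem_union, Finset.mem_filter, Finset.mem_univ, true_and] at hp ⊢
    rcases lt_trichotomy p.1 p.2 with h | h | h
    · exact Or.inl ⟨h, hp⟩
    · exact absurd (h ▸ hp) (hirr _)
    · exact Or.inr ⟨h, hp⟩
  have hle := (Finset.card_le_card hsplit).trans (Finset.card_union_le _ _)
  have hsum : n * v ≤ ∑ j, (Finset.univ.filter (P j)).card := by
    simpa using Finset.card_nsmul_le_sum Finset.univ
      (fun j => (Finset.univ.filter (P j)).card) v (fun j _ => hdeg j)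
  omega

theorem not_convexOn_udLossAug {d m n v : ℕ} {U : Set (EuclideanSpace ℝ (Fin d))} {R : ℝ}
    (hR : ∀ x ∈ U, ‖x‖ ≤ R) {a : Fin m → EuclideanSpace ℝ (Fin d)} (ha : ∀ i, a i ∈ U)
    {r b c δ : ℝ} (hb : 0 < b) (hc : 0 < c) (hδ : 0 < δ)
    {S : Fin n → EuclideanSpace ℝ (Fin d)} (hS : ∀ i, S i ∈ U) (hn : 0 < n)
    (hv : (m : ℝ) * ((2 * R) ^ b) ^ c < v * (δ ^ b) ^ c)
    (hdeg : ∀ j, v ≤ (Finset.univ.filter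
      (fun i => δ ≤ dist (S j) (S i) ∧ dist (S j) (S i) ≤ r)).card) :
    ¬ ConvexOn ℝ Set.univ (udLossAug a r b c S) := by
  intro hconv
  have hplus : udLossAug a r b c S (fun j => padPoint n (S j)) = 0 := by
    simp [udLossAug, norm_padPoint_sub, Real.zero_rpow hc.ne']
  have hminus : udLossAug a r b c S (fun j => -padPoint n (S j)) ≤
      n * (m * ((2 * R) ^ b) ^ c) := by
    have hzero : ∀ i j, ‖-padPoint n (S i) - -padPoint n (S j)‖ = dist (S i) (S j) := by
      intro i j
      rw [← norm_padPoint_sub n, ← norm_neg]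
      congr 1
      abel
    simp only [udLossAug, hzero, sub_self, abs_zero, Real.zero_rpow hc.ne',
      Finset.sum_const_zero, zero_add]
    calc _ ≤ ∑ _p ∈ Finset.univ.filter
          (fun p : Fin m × Fin n => dist (a p.1) (S p.2) ≤ r), ((2 * R) ^ b) ^ c := by
          refine Finset.sum_le_sum fun p _ => ?_
          have h₁ := hR _ (ha p.1)
          have h₂ := hR _ (hS p.2)
          refine abs_rpow_sub_rpow_rpow_le (norm_nonneg _) dist_nonneg ?_ ?_ hb hc
          · refine (norm_sub_le _ _).trans ?_
            rw [norm_neg, norm_padPoint, norm_padPoint]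
            linarith
          · rw [dist_eq_norm]
            exact (norm_sub_le _ _).trans (by linarith)
      _ ≤ ∑ _p : Fin m × Fin n, ((2 * R) ^ b) ^ c := by
          have hR0 : 0 ≤ R := (norm_nonneg _).trans (hR _ (hS ⟨0, hn⟩))
          exact Finset.sum_le_sum_of_subset_of_nonneg (Finset.filter_subset _ _)
            fun _ _ _ => by positivity
      _ = n * (m * ((2 * R) ^ b) ^ c) := by
          simp
          ring
  have hzero : (n : ℝ) * (v * (δ ^ b) ^ c) ≤ 2 * udLossAug a r b c S 0 := by
    have hcard := mul_le_two_mul_card_filter_lt (v := v)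
      (fun j i => δ ≤ dist (S j) (S i) ∧ dist (S j) (S i) ≤ r)
      (fun i j h => by rwa [dist_comm (S j) (S i)])
      (fun i h => by rw [dist_self] at h; linarith [h.1]) hdeg
    have hcard' : (n : ℝ) * v ≤ 2 * ((Finset.univ.filter (fun p : Fin n × Fin n => p.1 < p.2 ∧
        δ ≤ dist (S p.1) (S p.2) ∧ dist (S p.1) (S p.2) ≤ r)).card : ℝ) := by
      exact_mod_cast hcard
    have hloss : ((Finset.univ.filter (fun p : Fin n × Fin n => p.1 < p.2 ∧
        δ ≤ dist (S p.1) (S p.2) ∧ dist (S p.1) (S p.2) ≤ r)).card : ℝ) * (δ ^ b) ^ c ≤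
        udLossAug a r b c S 0 := by
      rw [← nsmul_eq_mul]
      unfold udLossAug
      refine le_add_of_le_of_nonneg ?_ (Finset.sum_nonneg fun _ _ => by positivity)
      refine le_trans (Finset.card_nsmul_le_sum _
        (fun p : Fin n × Fin n => |‖(0 : EuclideanSpace ℝ (Fin (n + d)))
          - 0‖ ^ b - dist (S p.1) (S p.2) ^ b| ^ c) _ ?_)
        (Finset.sum_le_sum_of_subset_of_nonneg ?_ fun _ _ _ => by positivity)
      · intro p hp
        simp only [Finset.mem_filter, Finset.mem_univ, true_and] at hp
        rw [sub_zero, norm_zero, Real.zero_rpow hb.ne', zero_sub, abs_neg,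
          abs_of_nonneg (Real.rpow_nonneg dist_nonneg b)]
        have := hp.2.1
        gcongr
      · intro p hp
        simp only [Finset.mem_filter, Finset.mem_univ, true_and] at hp ⊢
        exact ⟨hp.1, hp.2.2⟩
    have hpos : 0 ≤ (δ ^ b) ^ c := by positivity
    nlinarith [mul_le_mul_of_nonneg_right hcard' hpos]
  have hmid := hconv.2 (Set.mem_univ (fun j => padPoint n (S j)))
    (Set.mem_univ (fun j => -padPoint n (S j)))
    (by norm_num : (0 : ℝ) ≤ 1 / 2) (by norm_num : (0 : ℝ) ≤ 1 / 2) (by norm_num)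
  have hmid0 : (1 / 2 : ℝ) • (fun j => padPoint n (S j)) +
      (1 / 2 : ℝ) • (fun j => -padPoint n (S j)) = 0 := by
    ext j
    simp
  rw [hmid0, hplus] at hmid
  simp only [smul_eq_mul] at hmid
  have hn' : (0 : ℝ) < n := by exact_mod_cast hn
  nlinarith [mul_lt_mul_of_pos_left hv hn']

/-- Conditioning on one coordinate: the probability that none of the other coordinates outside
`T` is related to it decays exponentially in their number. -/
theorem pi_forall_not_le {E : Type*} [MeasurableSpace E] (μ : Measure E)
    [IsProbabilityMeasure μ] {A : Set (E × E)} (hA : MeasurableSet A) {p : ℝ} (hp : p ≤ 1)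
    (hmin : ∀ᵐ x ∂μ, ENNReal.ofReal p ≤ μ {y | (x, y) ∈ A}) {k : ℕ} (j : Fin (k + 1))
    (T : Finset (Fin k)) :
    Measure.pi (fun _ : Fin (k + 1) => μ) {S | ∀ i ∉ T, (S j, S (j.succAbove i)) ∉ A} ≤
      ENNReal.ofReal ((1 - p) ^ (k - T.card)) := by
  have hmp := measurePreserving_piFinSuccAbove (fun _ : Fin (k + 1) => μ) j
  have hB : MeasurableSet {q : E × (Fin k → E) | ∀ i ∉ T, (q.1, q.2 i) ∉ A} := by
    have : {q : E × (Fin k → E) | ∀ i ∉ T, (q.1, q.2 i) ∉ A} =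
        ⋂ i, ⋂ (_ : i ∉ T), (fun q : E × (Fin k → E) => (q.1, q.2 i)) ⁻¹' Aᶜ := by
      ext q
      simp
    rw [this]
    refine MeasurableSet.iInter fun i => MeasurableSet.iInter fun _ => ?_
    exact (by fun_prop : Measurable fun q : E × (Fin k → E) => (q.1, q.2 i)) hA.compl
  have hpre : {S : Fin (k + 1) → E | ∀ i ∉ T, (S j, S (j.succAbove i)) ∉ A} =
      MeasurableEquiv.piFinSuccAbove (fun _ => E) j ⁻¹'
        {q : E × (Fin k → E) | ∀ i ∉ T, (q.1, q.2 i) ∉ A} := rfl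
  rw [hpre, hmp.measure_preimage hB.nullMeasurableSet, Measure.prod_apply hB]
  have hbound : ∀ᵐ x ∂μ, Measure.pi (fun _ : Fin k => μ)
      (Prod.mk x ⁻¹' {q : E × (Fin k → E) | ∀ i ∉ T, (q.1, q.2 i) ∉ A}) ≤
      ENNReal.ofReal ((1 - p) ^ (k - T.card)) := by
    filter_upwards [hmin] with x hx
    have hslice : Prod.mk x ⁻¹' {q : E × (Fin k → E) | ∀ i ∉ T, (q.1, q.2 i) ∉ A} =
        Set.pi Set.univ (fun i => if i ∈ T then Set.univ else {y | (x, y) ∈ A}ᶜ) := by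
      ext S
      simp only [Set.mem_preimage, Set.mem_ofPred_eq, Set.mem_pi, Set.mem_univ, true_implies]
      refine forall_congr' fun i => ?_
      by_cases hi : i ∈ T <;> simp [hi]
    have hAx : MeasurableSet {y | (x, y) ∈ A} := measurable_prodMk_left hA
    have hone : μ {y | (x, y) ∈ A}ᶜ ≤ ENNReal.ofReal (1 - p) := by
      rw [prob_compl_eq_one_sub hAx]
      rcases le_or_gt 0 p with h0 | h0
      · rw [ENNReal.ofReal_sub _ h0, ENNReal.ofReal_one]
        exact tsub_le_tsub_left hx _
      · exact tsub_le_self.trans (ENNReal.one_le_ofReal.mpr (by linarith))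
    rw [hslice, Measure.pi_pi]
    calc _ = ∏ i, if i ∈ T then 1 else μ {y | (x, y) ∈ A}ᶜ := by
          refine Finset.prod_congr rfl fun i _ => ?_
          split_ifs <;> simp
      _ = μ {y | (x, y) ∈ A}ᶜ ^ (k - T.card) := by
          rw [Finset.prod_ite]
          simp [Finset.filter_not, Finset.card_sdiff]
      _ ≤ ENNReal.ofReal (1 - p) ^ (k - T.card) := by gcongr
      _ = _ := (ENNReal.ofReal_pow (by linarith) _).symm
  calc _ ≤ ∫⁻ _, ENNReal.ofReal ((1 - p) ^ (k - T.card)) ∂μ := lintegral_mono_ae hbound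
    _ = _ := by simp

theorem pi_exists_card_lt_le {E : Type*} [MeasurableSpace E] (μ : Measure E)
    [IsProbabilityMeasure μ] {A : Set (E × E)} (hA : MeasurableSet A) {p : ℝ} (hp : p ≤ 1)
    (hmin : ∀ᵐ x ∂μ, ENNReal.ofReal p ≤ μ {y | (x, y) ∈ A}) {n v : ℕ} (hv : 1 ≤ v)
    (hvn : v ≤ n) :
    Measure.pi (fun _ : Fin n => μ)
        {S | ∃ j, (Finset.univ.filter (fun i => (S j, S i) ∈ A)).card < v} ≤
      ENNReal.ofReal (n * (n - 1).choose (v - 1) * (1 - p) ^ (n - v)) := by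
  obtain ⟨k, rfl⟩ : ∃ k, n = k + 1 := ⟨n - 1, by omega⟩
  have hsub : {S : Fin (k + 1) → E |
        ∃ j, (Finset.univ.filter (fun i => (S j, S i) ∈ A)).card < v} ⊆
      ⋃ j ∈ (Finset.univ : Finset (Fin (k + 1))),
        ⋃ T ∈ Finset.powersetCard (v - 1) (Finset.univ : Finset (Fin k)),
          {S | ∀ i ∉ T, (S j, S (j.succAbove i)) ∉ A} := by
    rintro S ⟨j, hj⟩
    have hle : (Finset.univ.filter (fun i => (S j, S (j.succAbove i)) ∈ A)).card ≤ v - 1 := by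
      refine Nat.le_sub_one_of_lt (lt_of_le_of_lt ?_ hj)
      refine Finset.card_le_card_of_injOn j.succAbove ?_ Fin.succAbove_right_injective.injOn
      intro i hi
      simpa using hi
    obtain ⟨T, hT, hcard⟩ := Finset.exists_superset_card_eq hle (by simp; omega)
    simp only [Set.mem_iUnion]
    refine ⟨j, Finset.mem_univ _, T, by simp [hcard], fun i hi hmem => hi (hT ?_)⟩
    simpa using hmem
  refine (measure_mono hsub).trans ?_
  refine (measure_biUnion_finset_le _ _).trans ?_
  have hq : (0 : ℝ) ≤ (1 - p) ^ (k + 1 - v) := pow_nonneg (by linarith) _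
  calc _ ≤ ∑ _j : Fin (k + 1), ∑ _T ∈ Finset.powersetCard (v - 1) (Finset.univ : Finset (Fin k)),
        ENNReal.ofReal ((1 - p) ^ (k + 1 - v)) := by
        refine Finset.sum_le_sum fun j _ => (measure_biUnion_finset_le _ _).trans ?_
        refine Finset.sum_le_sum fun T hT => ?_
        have hT' := (Finset.mem_powersetCard.mp hT).2
        have := pi_forall_not_le μ hA hp hmin j T
        rwa [hT', show k - (v - 1) = k + 1 - v by omega] at this
    _ = _ := by
        simp only [Finset.sum_const, Finset.card_powersetCard, Finset.card_univ,
          Fintype.card_fin, nsmul_eq_mul, Nat.add_sub_cancel]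
        rw [ENNReal.ofReal_mul (by positivity), ENNReal.ofReal_mul (by positivity),
          ENNReal.ofReal_natCast, ENNReal.ofReal_natCast, mul_assoc]

theorem one_le_pi_not_convexOn_add {d m : ℕ} {U : Set (EuclideanSpace ℝ (Fin d))}
    (hUne : U.Nonempty) (hUb : Bornology.IsBounded U) (hUopen : IsOpen U)
    {a : Fin m → EuclideanSpace ℝ (Fin d)} (ha : ∀ i, a i ∈ U)
    {r b c δ p : ℝ} (hb : 0 < b) (hc : 0 < c) (hδ : 0 < δ) (hp : p ≤ 1)
    (hmin : ∀ x ∈ U, ENNReal.ofReal p ≤ unifMeasure U {s | δ ≤ dist x s ∧ dist x s ≤ r}) :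
    ∃ V : ℕ, ∀ v n : ℕ, V ≤ v → v ≤ n →
      1 ≤ Measure.pi (fun _ : Fin n => unifMeasure U)
          {S | ¬ ConvexOn ℝ Set.univ (udLossAug a r b c S)} +
        ENNReal.ofReal (n * (n - 1).choose (v - 1) * (1 - p) ^ (n - v)) := by
  have := isProbabilityMeasure_unifMeasure hUne hUb hUopen
  obtain ⟨R, hR⟩ := hUb.exists_norm_le
  obtain ⟨V, hV⟩ := exists_nat_gt ((m : ℝ) * ((2 * R) ^ b) ^ c / (δ ^ b) ^ c)
  refine ⟨V + 1, fun v n hVv hvn => ?_⟩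
  have hpos : 0 < (δ ^ b) ^ c := by positivity
  have hv : (m : ℝ) * ((2 * R) ^ b) ^ c < v * (δ ^ b) ^ c := by
    rw [← div_lt_iff₀ hpos]
    exact hV.trans_le (by exact_mod_cast (by omega : V ≤ v))
  set A : Set (EuclideanSpace ℝ (Fin d) × EuclideanSpace ℝ (Fin d)) :=
    {q | δ ≤ dist q.1 q.2 ∧ dist q.1 q.2 ≤ r}
  have hA : MeasurableSet A :=
    (measurableSet_le measurable_const measurable_dist).inter
      (measurableSet_le measurable_dist measurable_const)
  have hae := ae_mem_unifMeasure hUopen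
  have hbad := pi_exists_card_lt_le (unifMeasure U) hA hp
    (hae.mono fun x hx => hmin x hx) (by omega : 1 ≤ v) hvn
  have hout : Measure.pi (fun _ : Fin n => unifMeasure U) {S | ¬ ∀ i, S i ∈ U} = 0 := by
    rw [← ae_iff]
    exact ae_all_iff.mpr fun i => (Measure.tendsto_eval_ae_ae (i := i)).eventually hae
  have hcover : (Set.univ : Set (Fin n → EuclideanSpace ℝ (Fin d))) ⊆
      ({S | ¬ ConvexOn ℝ Set.univ (udLossAug a r b c S)} ∪
        {S | ∃ j, (Finset.univ.filter (fun i => (S j, S i) ∈ A)).card < v}) ∪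
        {S | ¬ ∀ i, S i ∈ U} := by
    intro S _
    by_contra hS
    simp only [Set.mem_union, Set.mem_ofPred_eq, not_or, not_not, not_exists, not_lt] at hS
    exact not_convexOn_udLossAug hR ha hb hc hδ hS.2 (by omega) hv hS.1.2 hS.1.1
  calc (1 : ENNReal) = Measure.pi (fun _ : Fin n => unifMeasure U) Set.univ :=
        measure_univ.symm
    _ ≤ _ := measure_mono hcover
    _ ≤ _ := measure_union_le _ _
    _ ≤ _ := add_le_add (measure_union_le _ _) hout.le
    _ ≤ _ := by
        rw [add_zero]
        refine add_le_add le_rfl (le_of_eq_of_le ?_ hbad)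
        congr!

theorem tendsto_mul_choose_mul_pow {q : ℝ} (hq0 : 0 ≤ q) (hq1 : q < 1) (v : ℕ) :
    Filter.Tendsto (fun n : ℕ => (n : ℝ) * (n - 1).choose (v - 1) * q ^ (n - v))
      Filter.atTop (nhds 0) := by
  rw [← Filter.tendsto_add_atTop_iff_nat v]
  have hlim : Filter.Tendsto (fun n : ℕ => ((v : ℝ) + 1) ^ (v + 1) * ((n : ℝ) ^ (v + 1) * q ^ n))
      Filter.atTop (nhds 0) := by
    simpa using (tendsto_pow_const_mul_const_pow_of_abs_lt_one (v + 1)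
      (by rwa [abs_of_nonneg hq0])).const_mul (((v : ℝ) + 1) ^ (v + 1))
  refine squeeze_zero' (Filter.Eventually.of_forall fun n => by positivity) ?_ hlim
  filter_upwards [Filter.eventually_ge_atTop 1] with n hn
  have hchoose : (n + v) * (n + v - 1).choose (v - 1) ≤ ((v + 1) * n) ^ (v + 1) := by
    have hle : n + v ≤ (v + 1) * n := by nlinarith
    calc (n + v) * (n + v - 1).choose (v - 1)
        ≤ (n + v) * (n + v - 1) ^ (v - 1) := by gcongr; exact Nat.choose_le_pow _ _
      _ ≤ ((v + 1) * n) * ((v + 1) * n) ^ v := by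
          refine Nat.mul_le_mul hle ?_
          calc (n + v - 1) ^ (v - 1) ≤ ((v + 1) * n) ^ (v - 1) := by gcongr; omega
            _ ≤ ((v + 1) * n) ^ v := Nat.pow_le_pow_right (by positivity) (by omega)
      _ = _ := by ring
  have hcast : ((n + v : ℕ) : ℝ) * (n + v - 1).choose (v - 1) ≤
      (((v : ℝ) + 1) * n) ^ (v + 1) := by
    exact_mod_cast hchoose
  rw [Nat.add_sub_cancel, ← mul_assoc, ← mul_pow]
  gcongr

/-- The directly dimension-augmented loss function is non-convex with high probability
(at least `1 − n·v·C(n−1,v−1)·(1−p_r)^{n−v}`, `v = ⌊√n⌋`); in particular for every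
`p₀ < 1` the probability of non-convexity eventually exceeds `p₀`. -/
theorem stmt3 {d m : ℕ} (U : Set (EuclideanSpace ℝ (Fin d)))
    (hUne : U.Nonempty) (hUb : Bornology.IsBounded U) (hUconn : IsConnected U)
    (hUopen : IsOpen U)
    (a : Fin m → EuclideanSpace ℝ (Fin d)) (ha : ∀ i, a i ∈ U)
    (r b c : ℝ) (hr : 0 < r) (hb : 0 < b) (hc : 0 < c)
    (ε pr : ℝ) (hε : ε ∈ Set.Ioo (0 : ℝ) 1) (hpr : pr ∈ Set.Ioc (0 : ℝ) 1)
    (hmin : ∀ x ∈ U, ENNReal.ofReal pr ≤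
      unifMeasure U {s' | ε * r ≤ dist x s' ∧ dist x s' ≤ r}) :
    (∃ N : ℕ, ∀ n : ℕ, n > N →
      ENNReal.ofReal (1 - (n : ℝ) * (Nat.sqrt n : ℝ)
          * ((n - 1).choose (Nat.sqrt n - 1) : ℝ) * (1 - pr) ^ (n - Nat.sqrt n)) ≤
        Measure.pi (fun _ : Fin n => unifMeasure U)
          {S | ¬ ConvexOn ℝ Set.univ (udLossAug a r b c S)})
    ∧ (∀ p₀ : ℝ, p₀ < 1 → ∃ N : ℕ, ∀ n : ℕ, n > N →
      ENNReal.ofReal p₀ <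
        Measure.pi (fun _ : Fin n => unifMeasure U)
          {S | ¬ ConvexOn ℝ Set.univ (udLossAug a r b c S)}) := by
  obtain ⟨V, hV⟩ := one_le_pi_not_convexOn_add hUne hUb hUopen ha hb hc
    (mul_pos hε.1 hr) hpr.2 hmin
  have hq : 0 ≤ 1 - pr := by linarith [hpr.2]
  constructor
  · refine ⟨(V + 1) ^ 2, fun n hn => ?_⟩
    have hsqrt : V + 1 ≤ Nat.sqrt n := Nat.le_sqrt'.mpr hn.le
    refine le_trans ?_ (tsub_le_iff_right.mpr
      (hV (Nat.sqrt n) n (by omega) (Nat.sqrt_le_self n)))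
    rw [ENNReal.ofReal_sub _ (by positivity), ENNReal.ofReal_one]
    refine tsub_le_tsub_left (ENNReal.ofReal_le_ofReal ?_) _
    have hone : (1 : ℝ) ≤ Nat.sqrt n := by exact_mod_cast (by omega : 1 ≤ Nat.sqrt n)
    gcongr
    exact le_mul_of_one_le_right (Nat.cast_nonneg n) hone
  · intro p₀ hp₀
    have hsmall := (tendsto_mul_choose_mul_pow hq (by linarith [hpr.1]) V).eventually
      (gt_mem_nhds (lt_min (sub_pos.mpr hp₀) one_pos))
    obtain ⟨N, hN⟩ := Filter.eventually_atTop.mp hsmall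
    refine ⟨max N V, fun n hn => ?_⟩
    have hlt := hN n (by omega)
    refine lt_of_lt_of_le ?_ (tsub_le_iff_right.mpr (hV V n le_rfl (by omega)))
    rw [← ENNReal.ofReal_one, ← ENNReal.ofReal_sub _ (by positivity)]
    have h₁ := hlt.trans_le (min_le_left _ _)
    have h₂ := hlt.trans_le (min_le_right _ _)
    exact (ENNReal.ofReal_lt_ofReal_iff (by linarith)).mpr (by linarith)
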